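/- arXiv:1707.08109 — 2 statements merged into one kernel-verified Lean document; each statement's English description precedes it below -/
import Mathlib

section
/- Let Ω be a Martin-Löf random left-c.e. real with left-c.e. approximation (Ω_s), and let α be a left-c.e. real with left-c.e. approximation (α_s). Then α is not Martin-Löf random if and only if lim_s (α − α_s)/(Ω − Ω_s) = 0. -/
open scoped Classical

/-- A set of binary strings is prefix-free if no element is a proper prefix of another. -/
def PrefixFreeSet (D : Set (List Bool)) : Prop :=
  ∀ σ ∈ D, ∀ τ ∈ D, σ <+: τ → σ = τ

/-- A prefix-free machine: a partial computable function on binary strings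
whose domain is prefix-free. -/
structure PFMachine where
  f : List Bool →. List Bool
  partrec : Partrec f
  prefixFree : PrefixFreeSet {σ | (f σ).Dom}

/-- The halting probability `Ω_M = Σ_{σ ∈ dom M} 2^{-|σ|}` of a prefix-free machine. -/
noncomputable def omegaOf (M : PFMachine) : ℝ :=
  ∑' σ : {σ : List Bool // (M.f σ).Dom}, (2 : ℝ) ^ (-(σ.1.length : ℤ))

/-- A computable nondecreasing sequence of rationals converging to `x`. -/
def LeftCEApprox (q : ℕ → ℚ) (x : ℝ) : Prop :=
  Computable q ∧ Monotone q ∧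
    Filter.Tendsto (fun n => (q n : ℝ)) Filter.atTop (nhds x)

/-- A real is left-c.e. if some computable nondecreasing rational sequence converges to it. -/
def LeftCE (x : ℝ) : Prop := ∃ q : ℕ → ℚ, LeftCEApprox q x

/-- A real is right-c.e. if its negative is left-c.e. -/
def RightCE (x : ℝ) : Prop := LeftCE (-x)

/-- Martin-Löf randomness of a real, via computable sequences of open rational intervals. -/
def MLRandom (x : ℝ) : Prop :=
  ∀ I : ℕ → ℕ → ℚ × ℚ, Computable₂ I →
    (∀ n : ℕ, MeasureTheory.volume
        (⋃ k : ℕ, Set.Ioo (((I n k).1 : ℝ)) (((I n k).2 : ℝ))) ≤ 2 ^ (-(n : ℤ))) →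
    x ∉ ⋂ n : ℕ, ⋃ k : ℕ, Set.Ioo (((I n k).1 : ℝ)) (((I n k).2 : ℝ))

/-- A universal prefix-free machine: it simulates every prefix-free machine
via a fixed prefix. -/
def UniversalPF (U : PFMachine) : Prop :=
  ∀ M : PFMachine, ∃ ρ : List Bool, ∀ σ : List Bool, U.f (ρ ++ σ) = M.f σ

/-- The `i`-th binary digit of a real (of its expansion not ending in all 1s). -/
noncomputable def rdigit (x : ℝ) (i : ℕ) : Bool := decide (⌊x * 2 ^ (i + 1)⌋ % 2 = 1)

/-- The first `n` binary digits of a real. -/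
noncomputable def bits (x : ℝ) (n : ℕ) : List Bool := (List.range n).map (rdigit x)

/-- Prefix-free Kolmogorov complexity of `σ` with respect to machine `M`,
with value `⊤` if `σ` is not in the range. -/
noncomputable def Kf (M : PFMachine) (σ : List Bool) : ℕ∞ :=
  ⨅ p : {p : List Bool // σ ∈ M.f p}, (p.1.length : ℕ∞)

/-- An optimal prefix-free machine: minimizes `K` up to additive constants. -/
def OptimalPF (V : PFMachine) : Prop :=
  ∀ M : PFMachine, ∃ c : ℕ, ∀ σ : List Bool, Kf V σ ≤ Kf M σ + c

/-- Solovay reducibility for left-c.e. reals. -/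
def SolovayRed (α β : ℝ) : Prop :=
  ∃ c : ℚ, ∃ f : ℚ →. ℚ, Partrec f ∧
    ∀ q : ℚ, (q : ℝ) < β →
      ∃ r ∈ f q, (r : ℝ) < α ∧ α - (r : ℝ) < (c : ℝ) * (β - (q : ℝ))

/-- `X` is computable from `Y` with oracle-use `h`. -/
def ComputableFromWithUse (X Y : ℝ) (h : ℕ → ℕ) : Prop :=
  ∃ Φ : List Bool →. List Bool, Partrec Φ ∧
    ∀ n : ℕ, Φ (bits Y (h n)) = Part.some (bits X n)

/-- The code of a rational under its `Encodable` instance; its `Primcodable` code is the rank of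
this number among all such codes. -/
def ratCode (q : ℚ) : ℕ := Nat.pair (Equiv.intEquivNat q.num) q.den

theorem encode_eq_ratCode (q : ℚ) : @Encodable.encode ℚ Rat.instEncodable q = ratCode q := by
  obtain ⟨n, d, h1, h2⟩ := q
  rfl

theorem ratCode_injective : Function.Injective ratCode := fun p q h => by
  rw [← encode_eq_ratCode, ← encode_eq_ratCode] at h
  exact @Encodable.encode_injective ℚ Rat.instEncodable _ _ h

theorem ratCode_ofNat (n : ℕ) :
    ratCode (Denumerable.ofNat ℚ n) = Nat.nth (· ∈ Set.range ratCode) n := by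
  let : Encodable ℚ := Rat.instEncodable
  let := @Encodable.decidableRangeEncode ℚ _
  have hr : Set.range (@Encodable.encode ℚ Rat.instEncodable) = Set.range ratCode :=
    congrArg Set.range (funext encode_eq_ratCode)
  have hinf : (Set.range (@Encodable.encode ℚ Rat.instEncodable)).Infinite :=
    Set.infinite_range_of_injective (@Encodable.encode_injective ℚ Rat.instEncodable)
  let : Infinite (Set.range (@Encodable.encode ℚ _)) := hinf.to_subtype
  have h1 : Denumerable.ofNat ℚ n = (Encodable.equivRangeEncode ℚ).symm
      (Nat.Subtype.ofNat (Set.range (@Encodable.encode ℚ Rat.instEncodable)) n) := by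
    let := Nat.Subtype.denumerable (Set.range (@Encodable.encode ℚ _))
    exact (Denumerable.ofEquiv_ofNat _ (Encodable.equivRangeEncode ℚ) n).trans
      (congrArg _ (Denumerable.ofEquiv_ofNat ℕ _ n))
  have h2 : ∀ x, ratCode ((Encodable.equivRangeEncode ℚ).symm x) = x.1 := by
    intro x
    rw [← encode_eq_ratCode]
    exact congrArg Subtype.val ((Encodable.equivRangeEncode ℚ).apply_symm_apply x)
  rw [h1, h2, ← hr, Nat.nth_apply_eq_orderIsoOfNat
    (p := (· ∈ Set.range (@Encodable.encode ℚ Rat.instEncodable))) hinf n]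
  exact congrArg Subtype.val (Nat.Subtype.orderIsoOfNat_apply).symm

theorem encode_rat_eq_count (q : ℚ) :
    @Encodable.encode ℚ Primcodable.toEncodable q =
      Nat.count (· ∈ Set.range ratCode) (ratCode q) := by
  obtain ⟨n, rfl⟩ : ∃ n, q = Denumerable.ofNat ℚ n :=
    ⟨@Encodable.encode ℚ Primcodable.toEncodable q, (Denumerable.ofNat_encode q).symm⟩
  rw [ratCode_ofNat, Nat.count_nth_of_infinite (p := (· ∈ Set.range ratCode))
    (Set.infinite_range_of_injective ratCode_injective) n]
  exact Denumerable.encode_ofNat n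

/-- The rational number `(x - y) / (z + 1)`. -/
def ratMk (t : ℕ × ℕ × ℕ) : ℚ := ((t.1 : ℚ) - t.2.1) / (t.2.2 + 1)

theorem intEquivNat_ofNat (n : ℕ) : Equiv.intEquivNat n = 2 * n := rfl

theorem intEquivNat_negSucc (n : ℕ) : Equiv.intEquivNat (Int.negSucc n) = 2 * n + 1 := rfl

/-- The codes of positive and negative numerators are told apart by parity. -/
theorem ratCode_eq_iff (t : ℕ × ℕ × ℕ) (r : ℕ) : ratCode (ratMk t) = r ↔
    r ∈ Set.range ratCode ∧
    ((r.unpair.1 % 2 = 0 ∧ t.1 * r.unpair.2 = r.unpair.1 / 2 * (t.2.2 + 1) + t.2.1 * r.unpair.2) ∨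
    (r.unpair.1 % 2 = 1 ∧
      t.2.1 * r.unpair.2 = (r.unpair.1 / 2 + 1) * (t.2.2 + 1) + t.1 * r.unpair.2)) := by
  have key : ∀ q : ℚ, ratMk t = q ↔
    (((ratCode q).unpair.1 % 2 = 0 ∧ t.1 * (ratCode q).unpair.2 =
      (ratCode q).unpair.1 / 2 * (t.2.2 + 1) + t.2.1 * (ratCode q).unpair.2) ∨
    ((ratCode q).unpair.1 % 2 = 1 ∧ t.2.1 * (ratCode q).unpair.2 =
      ((ratCode q).unpair.1 / 2 + 1) * (t.2.2 + 1) + t.1 * (ratCode q).unpair.2)) := by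
    intro q
    have hd : (q.den : ℚ) ≠ 0 := by exact_mod_cast q.den_nz
    have hz : (t.2.2 + 1 : ℚ) ≠ 0 := by positivity
    have h0 : ratMk t = q ↔ ((t.1 : ℚ) - t.2.1) * q.den = q.num * (t.2.2 + 1) := by
      conv_lhs => rw [← Rat.num_div_den q]
      rw [ratMk, div_eq_div_iff hz hd]
    rw [h0, ratCode, Nat.unpair_pair]
    dsimp only
    rcases hn : q.num with a | a
    · rw [Int.ofNat_eq_natCast, intEquivNat_ofNat]
      have e1 : 2 * a % 2 = 0 := by lia
      have e2 : 2 * a / 2 = a := by lia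
      simp only [e1, e2, true_and, zero_ne_one, false_and, or_false]
      rw [← @Nat.cast_inj ℚ]
      push_cast
      constructor <;> intro h <;> linarith
    · rw [intEquivNat_negSucc]
      have e1 : (2 * a + 1) % 2 = 1 := by lia
      have e2 : (2 * a + 1) / 2 = a := by lia
      simp only [e1, e2, true_and, one_ne_zero, false_and, false_or]
      rw [← @Nat.cast_inj ℚ]
      push_cast
      constructor <;> intro h <;> linarith
  constructor
  · rintro rfl
    exact ⟨⟨_, rfl⟩, (key _).1 rfl⟩
  · rintro ⟨⟨q, rfl⟩, h⟩
    exact congrArg ratCode ((key q).2 h)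

theorem mem_range_ratCode (r : ℕ) : r ∈ Set.range ratCode ↔ 0 < r.unpair.2 ∧
    ¬ ∃ e < r.unpair.1 + r.unpair.2 + 2, 1 < e ∧ r.unpair.2 % e = 0 ∧
      ((r.unpair.1 + 1) / 2) % e = 0 := by
  have hnat : ∀ m : ℤ, (Equiv.intEquivNat m + 1) / 2 = m.natAbs := by
    rintro (a | a)
    · rw [Int.ofNat_eq_natCast, intEquivNat_ofNat]; simp; lia
    · rw [intEquivNat_negSucc]; simp; lia
  have hcop : ∀ a b N : ℕ, 0 < b → b < N → (a.Coprime b ↔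
      ¬ ∃ e < N, 1 < e ∧ b % e = 0 ∧ a % e = 0) := by
    intro a b N hb hN
    rw [Nat.coprime_iff_gcd_eq_one]
    constructor
    · rintro h ⟨e, -, he, h1, h2⟩
      have := Nat.dvd_gcd (Nat.dvd_of_mod_eq_zero h2) (Nat.dvd_of_mod_eq_zero h1)
      rw [h] at this
      have := Nat.le_of_dvd one_pos this
      lia
    · intro h
      by_contra hne
      have hpos := Nat.gcd_pos_of_pos_right a hb
      exact h ⟨a.gcd b, (Nat.gcd_le_right a hb).trans_lt hN, by lia,
        Nat.mod_eq_zero_of_dvd (Nat.gcd_dvd_right a b),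
        Nat.mod_eq_zero_of_dvd (Nat.gcd_dvd_left a b)⟩
  constructor
  · rintro ⟨q, rfl⟩
    rw [ratCode, Nat.unpair_pair]
    refine ⟨q.den_pos, ?_⟩
    dsimp only
    rw [hnat]
    exact (hcop _ _ _ q.den_pos (by lia)).1 q.reduced
  · rintro ⟨h1, h2⟩
    have hc : (Equiv.intEquivNat.symm r.unpair.1).natAbs.Coprime r.unpair.2 := by
      rw [hcop _ _ _ h1 (by lia : _ < r.unpair.1 + r.unpair.2 + 2), ← hnat,
        Equiv.apply_symm_apply]
      exact h2
    exact ⟨⟨Equiv.intEquivNat.symm r.unpair.1, r.unpair.2, h1.ne', hc⟩, by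
      simp [ratCode]⟩

theorem primrecPred_ratCode : PrimrecPred (· ∈ Set.range ratCode) := by
  have hu1 : Primrec fun r : ℕ => r.unpair.1 := Primrec.fst.comp Primrec.unpair
  have hu2 : Primrec fun r : ℕ => r.unpair.2 := Primrec.snd.comp Primrec.unpair
  have hR : PrimrecRel fun (e r : ℕ) => 1 < e ∧ r.unpair.2 % e = 0 ∧
      ((r.unpair.1 + 1) / 2) % e = 0 := by
    refine PrimrecPred.and (Primrec.nat_lt.comp (Primrec.const 1) Primrec.fst)
      (PrimrecPred.and ?_ ?_)
    · exact Primrec.eq.comp (Primrec.nat_mod.comp (hu2.comp Primrec.snd) Primrec.fst)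
        (Primrec.const 0)
    · exact Primrec.eq.comp (Primrec.nat_mod.comp (Primrec.nat_div.comp
        (Primrec.succ.comp (hu1.comp Primrec.snd)) (Primrec.const 2)) Primrec.fst)
        (Primrec.const 0)
  have h2 := (PrimrecRel.exists_lt hR).comp (Primrec.nat_add.comp
    (Primrec.nat_add.comp hu1 hu2) (Primrec.const 2)) Primrec.id
  exact (PrimrecPred.and (Primrec.nat_lt.comp (Primrec.const 0) hu2) h2.not).of_eq
    fun r => (mem_range_ratCode r).symm

theorem computable_ratMk : Computable ratMk := by
  have hu1 : Primrec fun r : ℕ => r.unpair.1 := Primrec.fst.comp Primrec.unpair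
  have hu2 : Primrec fun r : ℕ => r.unpair.2 := Primrec.snd.comp Primrec.unpair
  have hcode : Computable fun t => ratCode (ratMk t) := by
    have hP : PrimrecRel fun (t : ℕ × ℕ × ℕ) (r : ℕ) => ratCode (ratMk t) = r := by
      have hx : Primrec fun p : (ℕ × ℕ × ℕ) × ℕ => p.1.1 := Primrec.fst.comp Primrec.fst
      have hy : Primrec fun p : (ℕ × ℕ × ℕ) × ℕ => p.1.2.1 :=
        Primrec.fst.comp (Primrec.snd.comp Primrec.fst)
      have hz : Primrec fun p : (ℕ × ℕ × ℕ) × ℕ => p.1.2.2 + 1 :=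
        Primrec.succ.comp (Primrec.snd.comp (Primrec.snd.comp Primrec.fst))
      have hn := hu1.comp (Primrec.snd (α := ℕ × ℕ × ℕ))
      have hd := hu2.comp (Primrec.snd (α := ℕ × ℕ × ℕ))
      have hhalf := Primrec.nat_div.comp hn (Primrec.const 2)
      have hpar := fun i => Primrec.eq.comp (Primrec.nat_mod.comp hn (Primrec.const 2))
        (Primrec.const i)
      refine PrimrecPred.of_eq (PrimrecPred.and (primrecPred_ratCode.comp Primrec.snd)
        (PrimrecPred.or (PrimrecPred.and (hpar 0) (Primrec.eq.comp (Primrec.nat_mul.comp hx hd)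
          (Primrec.nat_add.comp (Primrec.nat_mul.comp hhalf hz) (Primrec.nat_mul.comp hy hd))))
        (PrimrecPred.and (hpar 1) (Primrec.eq.comp (Primrec.nat_mul.comp hy hd)
          (Primrec.nat_add.comp (Primrec.nat_mul.comp (Primrec.succ.comp hhalf) hz)
            (Primrec.nat_mul.comp hx hd))))))
        fun p => (ratCode_eq_iff p.1 p.2).symm
    have hex : ∀ t, ∃ r, ratCode (ratMk t) = r := fun t => ⟨_, rfl⟩
    refine (Computable.find (P := fun t r => ratCode (ratMk t) = r)
      ⟨_, hP.decide.to_comp⟩ hex).of_eq fun t => (Nat.find_spec (hex t)).symm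
  have hcount : Primrec fun r : ℕ => Nat.count (· ∈ Set.range ratCode) r := by
    have hite : Primrec₂ fun (_ : ℕ) (p : ℕ × ℕ) =>
        if p.1 ∈ Set.range ratCode then p.2 + 1 else p.2 :=
      Primrec.ite (primrecPred_ratCode.comp (Primrec.fst.comp Primrec.snd))
        (Primrec.succ.comp (Primrec.snd.comp Primrec.snd)) (Primrec.snd.comp Primrec.snd)
    refine (Primrec.nat_rec' Primrec.id (Primrec.const 0) hite).of_eq fun r => ?_
    induction r with
    | zero => simp
    | succ r ih =>
      rw [Nat.count_succ, ← ih]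
      simp only [id]
      split_ifs <;> rfl
  exact Computable.encode_iff.1 ((hcount.to_comp.comp hcode).of_eq fun t =>
    (encode_rat_eq_count _).symm)

theorem ratMk_surjective (q : ℚ) : ∃ t, ratMk t = q := by
  have hd : ((q.den - 1 : ℕ) : ℚ) + 1 = q.den := by
    rw [Nat.cast_sub q.den_pos]; simp
  refine ⟨(q.num.toNat, (-q.num).toNat, q.den - 1), ?_⟩
  rw [ratMk]
  dsimp only
  rw [hd]
  conv_rhs => rw [← Rat.num_div_den q]
  congr 1
  exact_mod_cast Int.toNat_sub_toNat_neg q.num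

/-- A computable choice of natural numbers `x`, `y`, `z` with `q = (x - y) / (z + 1)`. -/
theorem exists_computable_ratMk_section :
    ∃ s : ℚ → ℕ × ℕ × ℕ, Computable s ∧ ∀ q, ratMk (s q) = q := by
  have hex : ∀ q : ℚ, ∃ n, ratMk (Denumerable.ofNat (ℕ × ℕ × ℕ) n) = q := fun q => by
    obtain ⟨t, rfl⟩ := ratMk_surjective q
    exact ⟨Encodable.encode t, by rw [Denumerable.ofNat_encode]⟩
  have hP : ComputablePred fun p : ℚ × ℕ => ratMk (Denumerable.ofNat (ℕ × ℕ × ℕ) p.2) = p.1 :=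
    ⟨inferInstance, (Primrec.eq (α := ℚ)).decide.to_comp.comp (computable_ratMk.comp
      ((Computable.ofNat _).comp Computable.snd)) Computable.fst⟩
  exact ⟨fun q => Denumerable.ofNat _ (Nat.find (hex q)),
    (Computable.ofNat _).comp (Computable.find
      (P := fun q n => ratMk (Denumerable.ofNat (ℕ × ℕ × ℕ) n) = q) hP hex),
    fun q => Nat.find_spec (hex q)⟩

section RatArithmetic

variable {α : Type*} [Primcodable α]

theorem ratMk_add (x y z x' y' z' : ℕ) : ratMk (x * (z' + 1) + x' * (z + 1),
    y * (z' + 1) + y' * (z + 1), z * z' + z + z') = ratMk (x, y, z) + ratMk (x', y', z') := by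
  have h : (z : ℚ) + 1 ≠ 0 := by positivity
  have h' : (z' : ℚ) + 1 ≠ 0 := by positivity
  have h'' : (z : ℚ) * z' + z + z' + 1 ≠ 0 := by positivity
  simp only [ratMk]
  push_cast
  field_simp
  ring

theorem ratMk_mul (x y z x' y' z' : ℕ) : ratMk (x * x' + y * y', x * y' + y * x',
    z * z' + z + z') = ratMk (x, y, z) * ratMk (x', y', z') := by
  have h : (z : ℚ) + 1 ≠ 0 := by positivity
  have h' : (z' : ℚ) + 1 ≠ 0 := by positivity
  have h'' : (z : ℚ) * z' + z + z' + 1 ≠ 0 := by positivity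
  simp only [ratMk]
  push_cast
  field_simp
  ring

theorem ratMk_neg (x y z : ℕ) : ratMk (y, x, z) = -ratMk (x, y, z) := by
  simp only [ratMk]
  ring

theorem ratMk_pos_iff (x y z : ℕ) : 0 < ratMk (x, y, z) ↔ y < x := by
  have h : (0 : ℚ) < (z : ℚ) + 1 := by positivity
  rw [ratMk, div_pos_iff_of_pos_right h, sub_pos, Nat.cast_lt]

theorem computable_ratMk_triple {f g h : α → ℕ} (hf : Computable f) (hg : Computable g)
    (hh : Computable h) : Computable fun a => ratMk (f a, g a, h a) :=
  computable_ratMk.comp (hf.pair (hg.pair hh))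

theorem Computable.nat_add_fun {f g : α → ℕ} (hf : Computable f) (hg : Computable g) :
    Computable fun a => f a + g a :=
  Primrec.nat_add.to_comp.comp hf hg

theorem Computable.nat_mul_fun {f g : α → ℕ} (hf : Computable f) (hg : Computable g) :
    Computable fun a => f a * g a :=
  Primrec.nat_mul.to_comp.comp hf hg

theorem Computable.rat_add {f g : α → ℚ} (hf : Computable f) (hg : Computable g) :
    Computable fun a => f a + g a := by
  obtain ⟨s, hs, hsec⟩ := exists_computable_ratMk_section
  have h1 := hs.comp hf
  have h2 := hs.comp hg
  have x := fst.comp h1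
  have y := fst.comp (snd.comp h1)
  have z := snd.comp (snd.comp h1)
  have x' := fst.comp h2
  have y' := fst.comp (snd.comp h2)
  have z' := snd.comp (snd.comp h2)
  refine (computable_ratMk_triple
    ((x.nat_mul_fun (succ.comp z')).nat_add_fun (x'.nat_mul_fun (succ.comp z)))
    ((y.nat_mul_fun (succ.comp z')).nat_add_fun (y'.nat_mul_fun (succ.comp z)))
    (((z.nat_mul_fun z').nat_add_fun z).nat_add_fun z')).of_eq fun a => ?_
  exact (ratMk_add _ _ _ _ _ _).trans (congrArg₂ _ (hsec _) (hsec _))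

theorem Computable.rat_mul {f g : α → ℚ} (hf : Computable f) (hg : Computable g) :
    Computable fun a => f a * g a := by
  obtain ⟨s, hs, hsec⟩ := exists_computable_ratMk_section
  have h1 := hs.comp hf
  have h2 := hs.comp hg
  have x := fst.comp h1
  have y := fst.comp (snd.comp h1)
  have z := snd.comp (snd.comp h1)
  have x' := fst.comp h2
  have y' := fst.comp (snd.comp h2)
  have z' := snd.comp (snd.comp h2)
  refine (computable_ratMk_triple
    ((x.nat_mul_fun x').nat_add_fun (y.nat_mul_fun y'))
    ((x.nat_mul_fun y').nat_add_fun (y.nat_mul_fun x'))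
    (((z.nat_mul_fun z').nat_add_fun z).nat_add_fun z')).of_eq fun a => ?_
  exact (ratMk_mul _ _ _ _ _ _).trans (congrArg₂ _ (hsec _) (hsec _))

theorem Computable.rat_neg {f : α → ℚ} (hf : Computable f) : Computable fun a => -f a := by
  obtain ⟨s, hs, hsec⟩ := exists_computable_ratMk_section
  have h1 := hs.comp hf
  refine (computable_ratMk_triple (fst.comp (snd.comp h1)) (fst.comp h1)
    (snd.comp (snd.comp h1))).of_eq fun a => ?_
  exact (ratMk_neg _ _ _).trans (congrArg _ (hsec _))

theorem Computable.rat_sub {f g : α → ℚ} (hf : Computable f) (hg : Computable g) :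
    Computable fun a => f a - g a :=
  (hf.rat_add hg.rat_neg).of_eq fun _ => (sub_eq_add_neg _ _).symm

theorem Computable.rat_lt {f g : α → ℚ} (hf : Computable f) (hg : Computable g) :
    Computable fun a => decide (f a < g a) := by
  obtain ⟨s, hs, hsec⟩ := exists_computable_ratMk_section
  have h1 := hs.comp (hg.rat_sub hf)
  refine (Primrec.nat_lt.decide.to_comp.comp (fst.comp (snd.comp h1)) (fst.comp h1)).of_eq
    fun a => ?_
  have h : 0 < ratMk (s (g a - f a)) ↔ _ := ratMk_pos_iff _ _ _
  rw [hsec, sub_pos] at h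
  exact decide_eq_decide.2 h.symm

theorem Computable.rat_max {f g : α → ℚ} (hf : Computable f) (hg : Computable g) :
    Computable fun a => max (f a) (g a) := by
  refine (Computable.cond (hf.rat_lt hg) hg hf).of_eq fun a => ?_
  by_cases h : f a < g a
  · simp [h, h.le]
  · simp [h, not_lt.1 h]

theorem Computable.rat_pow (q : ℚ) : Computable fun n : ℕ => q ^ n := by
  have h : Computable₂ fun (_ : ℕ) (p : ℕ × ℚ) => p.2 * q :=
    (snd.comp snd).rat_mul (const q)
  refine (Computable.nat_rec Computable.id (const 1) h).of_eq fun n => ?_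
  induction n with
  | zero => simp
  | succ n ih => rw [pow_succ, ← ih]; rfl

end RatArithmetic

/-- The least point of `[l, u]` at which `f` attains its maximum on `[l, u]`. -/
def firstMax (f : ℕ → ℚ) (l : ℕ) : ℕ → ℕ
  | 0 => 0
  | u + 1 => if u + 1 ≤ l ∨ f (firstMax f l u) < f (u + 1) then u + 1 else firstMax f l u

theorem firstMax_spec (f : ℕ → ℚ) {l u : ℕ} (h : l ≤ u) :
    l ≤ firstMax f l u ∧ firstMax f l u ≤ u ∧
      (∀ v, l ≤ v → v ≤ u → f v ≤ f (firstMax f l u)) ∧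
      ∀ v, l ≤ v → v < firstMax f l u → f v < f (firstMax f l u) := by
  induction u with
  | zero =>
    obtain rfl : l = 0 := by lia
    refine ⟨le_rfl, le_rfl, fun v _ hv => ?_, fun v _ hv => absurd hv (Nat.not_lt_zero v)⟩
    obtain rfl : v = 0 := by lia
    rfl
  | succ u ih =>
    rw [firstMax]
    split_ifs with hc
    · refine ⟨h, le_rfl, fun v hlv hvu => ?_, fun v hlv hvu => ?_⟩
      · rcases hvu.eq_or_lt with rfl | hvu
        · rfl
        · have hc' := hc.resolve_left (by lia)
          exact ((ih (by lia)).2.2.1 v hlv (by lia)).trans hc'.le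
      · have hc' := hc.resolve_left (by lia)
        exact ((ih (by lia)).2.2.1 v hlv (by lia)).trans_lt hc'
    · rw [not_or, not_lt] at hc
      obtain ⟨h1, h2, h3, h4⟩ := ih (by lia)
      refine ⟨h1, by lia, fun v hlv hvu => ?_, h4⟩
      rcases hvu.eq_or_lt with rfl | hvu
      · exact hc.2
      · exact h3 v hlv (by lia)

theorem firstMax_mono (f : ℕ → ℚ) {l u l' u' : ℕ} (hl : l ≤ l') (hu : u ≤ u') (h : l ≤ u)
    (h' : l' ≤ u') : firstMax f l u ≤ firstMax f l' u' := by
  obtain ⟨h1, h2, h3, h4⟩ := firstMax_spec f h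
  obtain ⟨h1', h2', h3', h4'⟩ := firstMax_spec f h'
  by_contra! hlt
  have hA := h4 _ (hl.trans h1') hlt
  have hB := h3' (firstMax f l u) (h1'.trans hlt.le) (h2.trans hu)
  exact absurd hB (not_le.2 hA)

theorem firstMax_le_of_tail_max (f : ℕ → ℚ) {l u a : ℕ} (hla : l ≤ a) (hau : a ≤ u)
    (ha : ∀ v, a ≤ v → f v ≤ f a) : firstMax f l u ≤ a := by
  obtain ⟨-, -, -, h4⟩ := firstMax_spec f (hla.trans hau)
  by_contra! hlt
  exact absurd (ha _ hlt.le) (not_le.2 (h4 a hla hlt))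

/-- Starting from `0`, move the left endpoint of `[0, u]` alternately to the first maximum of `f`
and to the first maximum of `g` on the remaining interval, `k` times each. -/
def alternatingMax (f g : ℕ → ℚ) (u : ℕ) : ℕ → ℕ
  | 0 => 0
  | k + 1 => firstMax g (firstMax f (alternatingMax f g u k) u) u

theorem alternatingMax_le (f g : ℕ → ℚ) (u k : ℕ) : alternatingMax f g u k ≤ u := by
  induction k with
  | zero => exact Nat.zero_le u
  | succ k ih => exact (firstMax_spec g (firstMax_spec f ih).2.1).2.1

theorem alternatingMax_mono (f g : ℕ → ℚ) (k : ℕ) : Monotone (alternatingMax f g · k) := by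
  intro u u' hu
  induction k with
  | zero => exact le_rfl
  | succ k ih =>
    have hle := alternatingMax_le f g
    exact firstMax_mono g (firstMax_mono f ih hu (hle u k) (hle u' k)) hu
      (firstMax_spec f (hle u k)).2.1 (firstMax_spec f (hle u' k)).2.1

/-- The total increment of `a` over the steps `u → u + 1` with `u < N` selected by `P`. -/
def selectedSum (P : ℕ → Bool) (a : ℕ → ℚ) (N : ℕ) : ℚ :=
  ∑ u ∈ Finset.range N, if P u then a (u + 1) - a u else 0

theorem selectedSum_succ (P : ℕ → Bool) (a : ℕ → ℚ) (N : ℕ) :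
    selectedSum P a (N + 1) = selectedSum P a N + if P N then a (N + 1) - a N else 0 :=
  Finset.sum_range_succ _ _

theorem selectedSum_monotone (P : ℕ → Bool) {a : ℕ → ℚ} (ha : Monotone a) :
    Monotone (selectedSum P a) := by
  refine monotone_nat_of_le_succ fun N => ?_
  rw [selectedSum_succ]
  have := ha N.le_succ
  split_ifs <;> linarith

theorem selectedSum_mono_pred {P Q : ℕ → Bool} (h : ∀ u, P u → Q u) {a : ℕ → ℚ}
    (ha : Monotone a) (N : ℕ) : selectedSum P a N ≤ selectedSum Q a N := by
  refine Finset.sum_le_sum fun u _ => ?_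
  have := ha u.le_succ
  by_cases hP : P u
  · simp [hP, h u hP]
  · simp only [hP, Bool.false_eq_true, if_false]
    split_ifs <;> linarith

theorem selectedSum_sub_mul (P : ℕ → Bool) (a b : ℕ → ℚ) (c : ℚ) (N : ℕ) :
    selectedSum P (fun u => a u - c * b u) N = selectedSum P a N - c * selectedSum P b N := by
  simp only [selectedSum, Finset.mul_sum, ← Finset.sum_sub_distrib]
  refine Finset.sum_congr rfl fun u _ => ?_
  split_ifs <;> ring

theorem selectedSum_eq_of_forall {P : ℕ → Bool} {s N : ℕ} (hs : s ≤ N) (a : ℕ → ℚ)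
    (h : ∀ u, s ≤ u → u < N → P u) : selectedSum P a N = selectedSum P a s + (a N - a s) := by
  induction N, hs using Nat.le_induction with
  | base => simp
  | succ N hsN ih =>
    rw [selectedSum_succ, ih fun u h1 h2 => h u h1 (by lia), if_pos (h N hsN N.lt_succ_self)]
    ring

theorem selectedSum_le_zero {p : ℕ → ℕ} (hp : Monotone p) (hple : ∀ u, p u ≤ u) {f : ℕ → ℚ}
    (hf : ∀ u, f u ≤ f (p u)) (N : ℕ) :
    selectedSum (fun u => decide (p (u + 1) ≤ u)) f N ≤ 0 := by
  induction N using Nat.strong_induction_on with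
  | _ N ih =>
    rcases N with _ | N
    · simp [selectedSum]
    · by_cases hN : p (N + 1) ≤ N
      · rw [selectedSum_eq_of_forall (hple (N + 1))]
        · have := ih (p (N + 1)) (by lia)
          have := hf (N + 1)
          linarith
        · intro u h1 h2
          exact decide_eq_true ((hp (by lia : u + 1 ≤ N + 1)).trans h1)
      · rw [selectedSum_succ, if_neg (by simpa using hN), add_zero]
        exact ih N N.lt_succ_self

section Oscillation

variable {a b : ℕ → ℚ} {c d : ℚ}

/-- The steps selected at level `k` when the slopes of `a` against `b` are compared with `c` and
`d`. -/
def oscillationStep (a b : ℕ → ℚ) (c d : ℚ) (k u : ℕ) : Bool :=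
  decide (alternatingMax (fun v => a v - c * b v) (fun v => -(a v - d * b v)) (u + 1) k ≤ u)

theorem selectedSum_neg (P : ℕ → Bool) (a : ℕ → ℚ) (N : ℕ) :
    selectedSum P (fun u => -a u) N = -selectedSum P a N := by
  simp only [selectedSum, ← Finset.sum_neg_distrib]
  refine Finset.sum_congr rfl fun u _ => ?_
  split_ifs <;> ring

theorem selectedSum_oscillationStep_succ_le (ha : Monotone a) (hb : Monotone b) (hc : 0 ≤ c)
    (k N : ℕ) : selectedSum (oscillationStep a b c d (k + 1)) a N ≤
      c * selectedSum (oscillationStep a b c d k) b N := by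
  set f := fun v => a v - c * b v with hf
  set g := fun v => -(a v - d * b v) with hg
  have hle := alternatingMax_le f g
  set p : ℕ → ℕ := fun u => firstMax f (alternatingMax f g u k) u with hp
  have h0 := selectedSum_le_zero (p := p) (f := f)
    (fun u u' hu => firstMax_mono f (alternatingMax_mono f g k hu) hu (hle u k) (hle u' k))
    (fun u => (firstMax_spec f (hle u k)).2.1)
    (fun u => (firstMax_spec f (hle u k)).2.2.1 u (hle u k) le_rfl) N
  rw [hf, selectedSum_sub_mul] at h0
  have h1 : selectedSum (oscillationStep a b c d (k + 1)) a N ≤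
      selectedSum (fun u => decide (p (u + 1) ≤ u)) a N :=
    selectedSum_mono_pred (fun u hu => decide_eq_true
      ((firstMax_spec g (firstMax_spec f (hle (u + 1) k)).2.1).1.trans (of_decide_eq_true hu)))
      ha N
  have h2 : selectedSum (fun u => decide (p (u + 1) ≤ u)) b N ≤
      selectedSum (oscillationStep a b c d k) b N :=
    selectedSum_mono_pred (fun u hu => decide_eq_true
      ((firstMax_spec f (hle (u + 1) k)).1.trans (of_decide_eq_true hu))) hb N
  have h3 := mul_le_mul_of_nonneg_left h2 hc
  linarith

theorem mul_selectedSum_oscillationStep_succ_le (k N : ℕ) :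
    d * selectedSum (oscillationStep a b c d (k + 1)) b N ≤
      selectedSum (oscillationStep a b c d (k + 1)) a N := by
  set f := fun v => a v - c * b v with hf
  set g := fun v => -(a v - d * b v) with hg
  have hp := fun u => (firstMax_spec f (alternatingMax_le f g u k)).2.1
  have h0 := selectedSum_le_zero (p := (alternatingMax f g · (k + 1))) (f := g)
    (alternatingMax_mono f g (k + 1)) (fun u => alternatingMax_le f g u (k + 1))
    (fun u => (firstMax_spec g (hp u)).2.2.1 u (hp u) le_rfl) N
  rw [hg, selectedSum_neg, selectedSum_sub_mul] at h0
  have : selectedSum (oscillationStep a b c d (k + 1)) = selectedSum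
    (fun u => decide (alternatingMax f g (u + 1) (k + 1) ≤ u)) := rfl
  rw [this]
  linarith

theorem selectedSum_oscillationStep_le (ha : Monotone a) (hb : Monotone b) (hd : 0 < d)
    (k N : ℕ) : selectedSum (oscillationStep a b (d / 2) d (k + 1)) a N ≤
      d * (1 / 2) ^ (k + 1) * (b N - b 0) := by
  induction k with
  | zero =>
    have h1 := selectedSum_oscillationStep_succ_le (d := d) ha hb (half_pos hd).le 0 N
    have h2 : selectedSum (oscillationStep a b (d / 2) d 0) b N = b N - b 0 := by
      rw [selectedSum_eq_of_forall (P := oscillationStep a b (d / 2) d 0) (Nat.zero_le N) b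
        fun u _ _ => decide_eq_true (Nat.zero_le u)]
      simp [selectedSum]
    rw [h2] at h1
    linarith
  | succ k ih =>
    have h1 := selectedSum_oscillationStep_succ_le (d := d) ha hb (half_pos hd).le (k + 1) N
    have h2 := mul_selectedSum_oscillationStep_succ_le (a := a) (b := b) (c := d / 2) (d := d) k N
    rw [pow_succ]
    linarith

end Oscillation

/-- A convergent sequence that exceeds its limit beyond `N` attains its maximum over `[N, ∞)`. -/
theorem exists_forall_ge_le_of_tendsto {f : ℕ → ℚ} {x : ℝ}
    (hf : Filter.Tendsto (fun n => (f n : ℝ)) Filter.atTop (nhds x)) {N t : ℕ} (ht : N ≤ t)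
    (hx : x < f t) : ∃ m, N ≤ m ∧ x < f m ∧ ∀ v, N ≤ v → f v ≤ f m := by
  obtain ⟨M, hM⟩ := Filter.eventually_atTop.1 (hf.eventually_lt_const hx)
  obtain ⟨m, hm, hmax⟩ := (Finset.Icc N (max M t)).exists_max_image f ⟨t, by simp [ht]⟩
  rw [Finset.mem_Icc] at hm
  have htm := hmax t (by simp [ht])
  refine ⟨m, hm.1, hx.trans_le (by exact_mod_cast htm), fun v hv => ?_⟩
  rcases le_or_gt v (max M t) with h | h
  · exact hmax v (Finset.mem_Icc.2 ⟨hv, h⟩)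
  · have := hM v (by lia)
    exact (by exact_mod_cast this.le : f v ≤ f t).trans htm

section Recursion

variable {α σ : Type*} [Primcodable α] [Primcodable σ]

theorem Computable.of_nat_rec {F : α → ℕ → σ} {h : α → ℕ × σ → σ} (h0 : Computable (F · 0))
    (hh : Computable₂ h) (hF : ∀ a n, F a (n + 1) = h a (n, F a n)) : Computable₂ F := by
  have hh' : Computable₂ fun (p : α × ℕ) (x : ℕ × σ) => h p.1 x := hh.comp (fst.comp fst) snd
  refine (Computable.nat_rec snd (h0.comp fst) hh').of_eq fun ⟨a, n⟩ => ?_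
  induction n with
  | zero => rfl
  | succ n ih => exact (congrArg (fun x => h a (n, x)) ih).trans (hF a n).symm

theorem Computable.decide_exists_lt {Q : α → ℕ → Bool} (hQ : Computable₂ Q) :
    Computable₂ fun a N => decide (∃ k < N, Q a k) := by
  have hh : Computable₂ fun (a : α) (p : ℕ × Bool) => p.2 || Q a p.1 :=
    Primrec.or.to_comp.comp (snd.comp snd) (hQ.comp fst (fst.comp snd))
  refine Computable.of_nat_rec ((Computable.const false).of_eq fun a => by simp) hh fun a N => ?_
  rw [← Bool.decide_coe (Q a N), ← Bool.decide_or, decide_eq_decide]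
  exact Nat.exists_lt_succ_right

theorem computable_selectedSum {P : α → ℕ → Bool} {a : ℕ → ℚ} (hP : Computable₂ P)
    (ha : Computable a) : Computable₂ fun x N => selectedSum (P x) a N := by
  have hN : Computable fun p : α × ℕ × ℚ => p.2.1 := Computable.fst.comp Computable.snd
  have hh : Computable₂ fun (x : α) (p : ℕ × ℚ) =>
      p.2 + cond (P x p.1) (a (p.1 + 1) - a p.1) 0 :=
    (Computable.snd.comp Computable.snd).rat_add (Computable.cond (hP.comp Computable.fst hN)
      ((ha.comp (Computable.succ.comp hN)).rat_sub (ha.comp hN)) (Computable.const 0))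
  have h0 (x : α) : selectedSum (P x) a 0 = 0 := Finset.sum_range_zero _
  refine Computable.of_nat_rec ((Computable.const 0).of_eq fun x => (h0 x).symm) hh fun x N => ?_
  rw [selectedSum_succ]
  cases P x N <;> rfl

end Recursion

theorem computable_firstMax {f : ℕ → ℚ} (hf : Computable f) : Computable₂ (firstMax f) := by
  have hu : Computable fun p : ℕ × ℕ × ℕ => p.2.1 + 1 :=
    Computable.succ.comp (Computable.fst.comp Computable.snd)
  have hm : Computable fun p : ℕ × ℕ × ℕ => p.2.2 := Computable.snd.comp Computable.snd
  have hh : Computable₂ fun (l : ℕ) (p : ℕ × ℕ) =>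
      cond (decide (p.1 + 1 ≤ l) || decide (f p.2 < f (p.1 + 1))) (p.1 + 1) p.2 :=
    Computable.cond (Primrec.or.to_comp.comp
      (Primrec.nat_le.decide.to_comp.comp hu Computable.fst)
      ((hf.comp hm).rat_lt (hf.comp hu))) hu hm
  refine Computable.of_nat_rec (Computable.const 0) hh fun l u => ?_
  rw [firstMax, ← Bool.decide_or, Bool.cond_decide]

theorem computable_alternatingMax {f g : ℕ → ℚ} (hf : Computable f) (hg : Computable g) :
    Computable₂ (alternatingMax f g) := by
  have hh : Computable₂ fun (u : ℕ) (p : ℕ × ℕ) => firstMax g (firstMax f p.2 u) u :=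
    (computable_firstMax hg).comp ((computable_firstMax hf).comp
      (Computable.snd.comp Computable.snd) Computable.fst) Computable.fst
  exact Computable.of_nat_rec (Computable.const 0) hh fun u k => rfl

theorem computable_oscillationStep {a b : ℕ → ℚ} (ha : Computable a) (hb : Computable b)
    (c d : ℚ) : Computable₂ (oscillationStep a b c d) :=
  have h (e : ℚ) : Computable fun v => a v - e * b v :=
    ha.rat_sub ((Computable.const e).rat_mul hb)
  Primrec.nat_le.decide.to_comp.comp ((computable_alternatingMax (h c) (h d).rat_neg).comp
    (Computable.succ.comp Computable.snd) Computable.fst) Computable.snd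

section Measure

open MeasureTheory

theorem two_zpow_neg_eq_ofReal (n : ℕ) :
    (2 : ENNReal) ^ (-(n : ℤ)) = ENNReal.ofReal ((1 / 2) ^ n) := by
  rw [ENNReal.ofReal_pow (by norm_num), one_div, ENNReal.ofReal_inv_of_pos two_pos,
    ENNReal.zpow_neg, zpow_natCast, ENNReal.inv_pow]
  simp

/-- The steps selected by `P` contribute no more than the measure of a set containing them. -/
theorem selectedSum_le_of_subset {P : ℕ → Bool} {a : ℕ → ℚ} (ha : Monotone a) {U : Set ℝ}
    (hP : ∀ u, P u → Set.Ioc (a u : ℝ) (a (u + 1)) ⊆ U) {r : ℝ} (hr : 0 ≤ r)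
    (hU : volume U ≤ ENNReal.ofReal r) (N : ℕ) : (selectedSum P a N : ℝ) ≤ r := by
  have ha' : Monotone fun u => (a u : ℝ) := fun u v h => Rat.cast_le.2 (ha h)
  rw [← ENNReal.ofReal_le_ofReal_iff hr]
  have h1 : (selectedSum P a N : ℝ) =
      ∑ u ∈ Finset.range N with P u, ((a (u + 1) : ℝ) - a u) := by
    rw [Finset.sum_filter, selectedSum]
    push_cast
    exact Finset.sum_congr rfl fun u _ => by split_ifs <;> simp
  have h2 : volume (⋃ u ∈ ({u ∈ Finset.range N | P u} : Finset ℕ),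
      Set.Ioc (a u : ℝ) (a (u + 1))) = ENNReal.ofReal (selectedSum P a N) := by
    rw [measure_biUnion_finset (f := fun u => Set.Ioc (a u : ℝ) (a (u + 1)))
      (fun u _ v _ huv => ha'.pairwise_disjoint_on_Ioc_succ huv) fun _ _ => measurableSet_Ioc, h1,
      ENNReal.ofReal_sum_of_nonneg fun u _ => sub_nonneg.2 (ha' u.le_succ)]
    simp only [Real.volume_Ioc]
  rw [← h2]
  refine (measure_mono (Set.iUnion₂_subset fun u hu => hP u ?_)).trans hU
  exact (Finset.mem_filter.1 hu).2

end Measure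

/-- Follow the increments of `x`, jumping to `b` whenever that is larger. -/
def raised (x b : ℕ → ℚ) : ℕ → ℚ
  | 0 => b 0
  | s + 1 => max (raised x b s + (x (s + 1) - x s)) (b (s + 1))

theorem computable_raised {x : ℕ → ℕ → ℚ} {b : ℕ → ℚ} (hx : Computable₂ x)
    (hb : Computable b) : Computable₂ fun n s => raised (x n) b s := by
  have hs : Computable fun p : ℕ × ℕ × ℚ => p.2.1 := Computable.fst.comp Computable.snd
  have hs' := Computable.succ.comp hs
  have hh : Computable₂ fun (n : ℕ) (p : ℕ × ℚ) =>
      max (p.2 + (x n (p.1 + 1) - x n p.1)) (b (p.1 + 1)) :=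
    ((Computable.snd.comp Computable.snd).rat_add ((hx.comp Computable.fst hs').rat_sub
      (hx.comp Computable.fst hs))).rat_max (hb.comp hs')
  exact Computable.of_nat_rec (Computable.const (b 0)) hh fun n s => rfl

theorem le_raised (x b : ℕ → ℚ) {t s : ℕ} (h : t ≤ s) : b t + (x s - x t) ≤ raised x b s := by
  induction s, h using Nat.le_induction with
  | base => cases t <;> simp [raised]
  | succ s _ ih => exact le_max_of_le_left (by linarith)

theorem LeftCEApprox.cast_le {b : ℕ → ℚ} {β : ℝ} (hb : LeftCEApprox b β) (s : ℕ) : b s ≤ β :=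
  Monotone.ge_of_tendsto (fun u v h => by exact_mod_cast hb.2.1 h) hb.2.2 s

theorem MLRandom.exists_forall_sub_le_aux {β : ℝ} {b : ℕ → ℚ} (hβ : MLRandom β)
    (hb : LeftCEApprox b β) {x : ℕ → ℕ → ℚ} (hx : Computable₂ x) (hmono : ∀ n, Monotone (x n))
    (hle : ∀ n s, 2 * (x n s - x n 0) ≤ (1 / 2) ^ n) :
    ∃ n, ∀ t s, t ≤ s → (x n s - x n t : ℝ) ≤ β - b t := by
  let I : ℕ → ℕ → ℚ × ℚ := fun n s => (raised (x n) b s - (x n (s + 1) - x n s),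
    raised (x n) b s + (x n (s + 1) - x n s))
  have hI : Computable₂ I := by
    have h1 : Computable fun p : ℕ × ℕ => x p.1 (p.2 + 1) - x p.1 p.2 :=
      (hx.comp Computable.fst (Computable.succ.comp Computable.snd)).rat_sub
        (hx.comp Computable.fst Computable.snd)
    exact ((computable_raised hx hb.1).rat_sub h1).pair ((computable_raised hx hb.1).rat_add h1)
  have hvol (n : ℕ) : MeasureTheory.volume
      (⋃ k : ℕ, Set.Ioo ((I n k).1 : ℝ) ((I n k).2 : ℝ)) ≤ 2 ^ (-(n : ℤ)) := by
    refine (MeasureTheory.measure_iUnion_le _).trans (ENNReal.tsum_le_of_sum_range_le fun N => ?_)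
    have hvk (k : ℕ) : MeasureTheory.volume (Set.Ioo ((I n k).1 : ℝ) ((I n k).2 : ℝ)) =
        ENNReal.ofReal (2 * (x n (k + 1) - x n k)) := by
      rw [Real.volume_Ioo]
      congr 1
      simp only [I]
      push_cast
      ring
    simp only [hvk]
    rw [two_zpow_neg_eq_ofReal, ← ENNReal.ofReal_sum_of_nonneg, ← Finset.mul_sum,
      Finset.sum_range_sub fun k => (x n k : ℝ)]
    · refine ENNReal.ofReal_le_ofReal ?_
      have : ((2 * (x n N - x n 0) : ℚ) : ℝ) ≤ ((1 / 2) ^ n : ℚ) := Rat.cast_le.2 (hle n N)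
      simpa using this
    · intro k _
      have : (x n k : ℝ) ≤ x n (k + 1) := by exact_mod_cast hmono n k.le_succ
      linarith
  have hnot := hβ I hI hvol
  simp only [Set.mem_iInter, Set.mem_iUnion, not_forall, not_exists] at hnot
  obtain ⟨n, hn⟩ := hnot
  have hraised (s : ℕ) : (raised (x n) b s : ℝ) ≤ β := by
    induction s with
    | zero => exact hb.cast_le 0
    | succ s ih =>
      rw [raised, Rat.cast_max]
      refine max_le ?_ (hb.cast_le _)
      by_contra! hlt
      refine hn s ⟨?_, ?_⟩
      · push_cast [I] at hlt ⊢
        linarith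
      · exact hlt
  refine ⟨n, fun t s hts => ?_⟩
  have h1 : ((b t + (x n s - x n t) : ℚ) : ℝ) ≤ raised (x n) b s := by
    exact_mod_cast le_raised (x n) b hts
  have h2 := hraised s
  push_cast at h1
  linarith

/-- A left-c.e. approximation of a random real cannot eventually be outrun by each of uniformly
computable nondecreasing sequences whose total increments decrease geometrically. -/
theorem MLRandom.exists_forall_sub_le {β : ℝ} {b : ℕ → ℚ} (hβ : MLRandom β)
    (hb : LeftCEApprox b β) {x : ℕ → ℕ → ℚ} (hx : Computable₂ x) (hmono : ∀ n, Monotone (x n))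
    {C : ℕ} (hle : ∀ n s, x n s - x n 0 ≤ C * (1 / 2) ^ n) :
    ∃ n, ∀ t s, t ≤ s → (x n s - x n t : ℝ) ≤ β - b t := by
  have hshift : Computable fun n => n + (C + 1) :=
    Computable.id.nat_add_fun (Computable.const (C + 1))
  obtain ⟨n, hn⟩ := hβ.exists_forall_sub_le_aux hb (x := fun n => x (n + (C + 1)))
    (hx.comp (hshift.comp Computable.fst) Computable.snd) (fun n => hmono _) fun n s => by
      have h1 := hle (n + (C + 1)) s
      have h2 : (C : ℚ) * (1 / 2) ^ C ≤ 1 := by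
        rw [one_div, inv_pow, ← div_eq_mul_inv, div_le_one (by positivity)]
        exact_mod_cast Nat.lt_two_pow_self.le
      have h3 : (C : ℚ) * (1 / 2) ^ (n + (C + 1)) =
          (C * (1 / 2) ^ C) * ((1 / 2) ^ n * (1 / 2)) := by ring
      have h4 := mul_le_mul_of_nonneg_right h2 (by positivity : (0 : ℚ) ≤ (1 / 2) ^ n * (1 / 2))
      linarith
  exact ⟨_, hn⟩

theorem MLRandom.ne_ratCast {β : ℝ} (hβ : MLRandom β) (q : ℚ) : β ≠ q := by
  rintro rfl
  have hb : LeftCEApprox (fun _ => q) (q : ℝ) :=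
    ⟨Computable.const q, monotone_const, tendsto_const_nhds⟩
  let x : ℕ → ℕ → ℚ := fun n s => if s = 0 then 0 else (1 / 2) ^ n
  have hx : Computable₂ x :=
    (Computable.cond ((Primrec.eq (α := ℕ)).decide.to_comp.comp Computable.snd
      (Computable.const 0)) (Computable.const 0)
      ((Computable.rat_pow (1 / 2)).comp Computable.fst)).of_eq fun p => by simp [x]
  have hmono (n : ℕ) : Monotone (x n) := monotone_nat_of_le_succ fun s => by
    simp only [x]
    split_ifs <;> first | positivity | simp_all
  obtain ⟨n, hn⟩ := hβ.exists_forall_sub_le hb hx hmono (C := 1) fun n s => by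
    simp only [x]
    split_ifs <;> simp
  have h := hn 0 1 zero_le_one
  have hpos : (0 : ℝ) < (1 / 2) ^ n := by positivity
  norm_num [x] at h
  linarith

theorem MLRandom.sub_pos {β : ℝ} {b : ℕ → ℚ} (hβ : MLRandom β) (hb : LeftCEApprox b β) (s : ℕ) :
    0 < β - b s :=
  _root_.sub_pos.2 ((hb.cast_le s).lt_of_ne (hβ.ne_ratCast _).symm)

theorem LeftCEApprox.exists_nat_sub_le {b : ℕ → ℚ} {β : ℝ} (hb : LeftCEApprox b β) :
    ∃ C : ℕ, ∀ N, b N - b 0 ≤ C := by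
  obtain ⟨C, hC⟩ := exists_nat_ge (β - b 0)
  refine ⟨C, fun N => ?_⟩
  have := hb.cast_le N
  exact_mod_cast (by linarith : (b N : ℝ) - b 0 ≤ C)

theorem LeftCEApprox.le_of_forall_sub_le {b : ℕ → ℚ} {β : ℝ} (hb : LeftCEApprox b β) {t : ℕ}
    {y : ℝ} (h : ∀ s, t ≤ s → (b s : ℝ) - b t ≤ y) : β - b t ≤ y :=
  le_of_tendsto (hb.2.2.sub_const _) (Filter.eventually_atTop.2 ⟨t, h⟩)

/-- No approximation of a left-c.e. real is much faster than an approximation of a random one. -/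
theorem MLRandom.exists_pow_mul_le {α β : ℝ} {a b : ℕ → ℚ} (hα : MLRandom α)
    (ha : LeftCEApprox a α) (hb : LeftCEApprox b β) :
    ∃ n : ℕ, ∀ t, (1 / 2) ^ n * (β - b t) ≤ α - a t := by
  obtain ⟨C, hC⟩ := hb.exists_nat_sub_le
  have hx : Computable₂ fun n s : ℕ => (1 / 2 : ℚ) ^ n * b s :=
    ((Computable.rat_pow (1 / 2)).comp Computable.fst).rat_mul (hb.1.comp Computable.snd)
  obtain ⟨n, hn⟩ := hα.exists_forall_sub_le ha hx
    (fun n s t hst => mul_le_mul_of_nonneg_left (hb.2.1 hst) (by positivity)) (C := C)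
    fun n s => by
      rw [← mul_sub, mul_comm]
      exact mul_le_mul_of_nonneg_right (hC s) (by positivity)
  refine ⟨n, fun t => ?_⟩
  rw [← le_div_iff₀' (by positivity)]
  refine hb.le_of_forall_sub_le fun s hs => ?_
  rw [le_div_iff₀' (by positivity)]
  have := hn t s hs
  push_cast at this
  linarith

/-- The approximation of a nonrandom left-c.e. real cannot eventually be slower by a constant
factor than an approximation of a random one. -/
theorem MLRandom.not_eventually_mul_le {α β : ℝ} {a b : ℕ → ℚ} (hα : ¬ MLRandom α)
    (ha : LeftCEApprox a α) (hβ : MLRandom β) (hb : LeftCEApprox b β) {c : ℚ} (hc : 0 < c) :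
    ¬ ∀ᶠ s in Filter.atTop, c * (β - b s) ≤ α - a s := by
  intro hev
  simp only [MLRandom, not_forall, not_not, exists_prop] at hα
  obtain ⟨I, hI, hvol, hmem⟩ := hα
  let P : ℕ → ℕ → Bool := fun n u =>
    decide (∃ k < u, (decide ((I n k).1 < a u) && decide (a (u + 1) < (I n k).2)) = true)
  have hP : Computable₂ P := by
    have hIk : Computable fun p : (ℕ × ℕ) × ℕ => I p.1.1 p.2 :=
      hI.comp (Computable.fst.comp Computable.fst) Computable.snd
    have hu : Computable fun p : (ℕ × ℕ) × ℕ => p.1.2 := Computable.snd.comp Computable.fst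
    have hQ : Computable₂ fun (p : ℕ × ℕ) (k : ℕ) =>
        decide ((I p.1 k).1 < a p.2) && decide (a (p.2 + 1) < (I p.1 k).2) :=
      Primrec.and.to_comp.comp ((Computable.fst.comp hIk).rat_lt (ha.1.comp hu))
        ((ha.1.comp (Computable.succ.comp hu)).rat_lt (Computable.snd.comp hIk))
    exact (Computable.decide_exists_lt hQ).comp Computable.id Computable.snd
  have hx : Computable₂ fun n N => 2 / c * selectedSum (P n) a N :=
    (Computable.const (2 / c)).rat_mul (computable_selectedSum hP ha.1)
  have hsel (n N : ℕ) : selectedSum (P n) a N ≤ (1 / 2) ^ n := by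
    have h := selectedSum_le_of_subset (P := P n) ha.2.1
      (U := ⋃ k, Set.Ioo ((I n k).1 : ℝ) (I n k).2) (r := (1 / 2) ^ n) (fun u hu => ?_) (by positivity)
      ((hvol n).trans_eq (two_zpow_neg_eq_ofReal n)) N
    · have h' : ((selectedSum (P n) a N : ℚ) : ℝ) ≤ (((1 / 2) ^ n : ℚ) : ℝ) := by simpa using h
      exact Rat.cast_le.1 h'
    · obtain ⟨k, -, hk⟩ := of_decide_eq_true hu
      simp only [Bool.and_eq_true, decide_eq_true_eq] at hk
      refine fun y hy => Set.mem_iUnion.2 ⟨k, ?_, ?_⟩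
      · exact (Rat.cast_lt.2 hk.1).trans hy.1
      · exact hy.2.trans_lt (Rat.cast_lt.2 hk.2)
  obtain ⟨C, hC⟩ := exists_nat_ge (2 / c)
  obtain ⟨n, hn⟩ := hβ.exists_forall_sub_le hb hx
    (fun n => (selectedSum_monotone (P n) ha.2.1).const_mul (by positivity)) (C := C) fun n s => by
      have h0 : selectedSum (P n) a 0 = 0 := Finset.sum_range_zero _
      rw [h0, mul_zero, sub_zero]
      exact mul_le_mul hC (hsel n s) (h0 ▸ selectedSum_monotone (P n) ha.2.1 (Nat.zero_le s))
        (by positivity)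
  obtain ⟨k, hk⟩ := Set.mem_iUnion.1 (Set.mem_iInter.1 hmem n)
  obtain ⟨M, hM⟩ := Filter.eventually_atTop.1
    ((ha.2.2.eventually_const_lt hk.1).and hev)
  have hPt (u : ℕ) (hu : max M (k + 1) ≤ u) : P n u = true := by
    refine decide_eq_true ⟨k, by lia, ?_⟩
    simp only [Bool.and_eq_true, decide_eq_true_eq]
    exact ⟨Rat.cast_lt.1 (hM u (by lia)).1, Rat.cast_lt.1 ((ha.cast_le _).trans_lt hk.2)⟩
  set t := max M (k + 1)
  have hc' : (0 : ℝ) < c := by exact_mod_cast hc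
  have h1 : α - a t ≤ c / 2 * (β - b t) := ha.le_of_forall_sub_le fun s hs => by
    have h := hn t s hs
    rw [selectedSum_eq_of_forall hs a fun u h1 _ => hPt u h1] at h
    push_cast at h
    have h' : 2 / (c : ℝ) * (a s - a t) ≤ β - b t := by linarith
    calc (a s - a t : ℝ) = c / 2 * (2 / (c : ℝ) * (a s - a t)) := by field_simp
      _ ≤ _ := mul_le_mul_of_nonneg_left h' (by positivity)
  have h2 := (hM t (le_max_left _ _)).2
  have h3 := mul_pos hc' (hβ.sub_pos hb t)
  linarith

/-- When the slope of `a` against `b` oscillates around `c` and `d`, the endpoint of the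
alternating maxima stabilizes. -/
theorem exists_forall_alternatingMax_le {f g : ℕ → ℚ} {x y : ℝ}
    (hf : Filter.Tendsto (fun n => (f n : ℝ)) Filter.atTop (nhds x))
    (hg : Filter.Tendsto (fun n => (g n : ℝ)) Filter.atTop (nhds y))
    (hfx : ∃ᶠ n in Filter.atTop, x < f n) (hgy : ∃ᶠ n in Filter.atTop, y < g n) (k : ℕ) :
    ∃ s, y < g s ∧ ∀ u, s ≤ u → alternatingMax f g u k ≤ s := by
  induction k with
  | zero =>
    obtain ⟨s, hs⟩ := hgy.exists
    exact ⟨s, hs, fun u _ => Nat.zero_le s⟩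
  | succ k ih =>
    obtain ⟨r, -, hr⟩ := ih
    obtain ⟨t, hrt, ht⟩ := Filter.frequently_atTop.1 hfx r
    obtain ⟨p, hrp, hp, hpmax⟩ := exists_forall_ge_le_of_tendsto hf hrt ht
    obtain ⟨t', hpt, ht'⟩ := Filter.frequently_atTop.1 hgy p
    obtain ⟨s, hps, hs, hsmax⟩ := exists_forall_ge_le_of_tendsto hg hpt ht'
    refine ⟨s, hs, fun u hu => ?_⟩
    have h1 := firstMax_le_of_tail_max f ((hr u (by lia)).trans hrp) (hps.trans hu)
      fun v hv => hpmax v (by lia)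
    exact firstMax_le_of_tail_max g (h1.trans hps) hu fun v hv => hsmax v (by lia)

/-- The speed of any left-c.e. approximation, compared to that of a random left-c.e. real, does not
oscillate. -/
theorem MLRandom.not_oscillating {α β : ℝ} {a b : ℕ → ℚ} (ha : LeftCEApprox a α)
    (hβ : MLRandom β) (hb : LeftCEApprox b β) {d : ℚ} (hd : 0 < d)
    (hlt : ∃ᶠ s in Filter.atTop, α - a s < d / 2 * (β - b s)) :
    ¬ ∃ᶠ s in Filter.atTop, d * (β - b s) < α - a s := by
  intro hgt
  have hP : Computable₂ fun n => oscillationStep a b (d / 2) d (n + 1) :=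
    (computable_oscillationStep ha.1 hb.1 (d / 2) d).comp
      (Computable.succ.comp Computable.fst) Computable.snd
  have hsum : Computable₂ fun n N => selectedSum (oscillationStep a b (d / 2) d (n + 1)) a N :=
    computable_selectedSum hP ha.1
  have hx : Computable₂ fun n N => d⁻¹ * selectedSum (oscillationStep a b (d / 2) d (n + 1)) a N :=
    (Computable.const d⁻¹).rat_mul hsum
  obtain ⟨C, hC⟩ := hb.exists_nat_sub_le
  obtain ⟨n, hn⟩ := hβ.exists_forall_sub_le hb hx
    (fun n => (selectedSum_monotone _ ha.2.1).const_mul (by positivity)) (C := C) fun n s => by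
      have h0 (P : ℕ → Bool) : selectedSum P a 0 = 0 := Finset.sum_range_zero _
      rw [h0, mul_zero, sub_zero, inv_mul_le_iff₀ hd]
      refine (selectedSum_oscillationStep_le ha.2.1 hb.2.1 hd n s).trans ?_
      rw [mul_assoc, mul_comm (C : ℚ)]
      have h1 : 0 ≤ b s - b 0 := _root_.sub_nonneg.2 (hb.2.1 (Nat.zero_le s))
      have h2 : (1 / 2 : ℚ) ^ (n + 1) ≤ (1 / 2) ^ n :=
        pow_le_pow_of_le_one (by norm_num) (by norm_num) n.le_succ
      exact mul_le_mul_of_nonneg_left (mul_le_mul h2 (hC s) h1 (by positivity)) hd.le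
  have hlim (e : ℚ) : Filter.Tendsto (fun v => ((a v - e * b v : ℚ) : ℝ)) Filter.atTop
      (nhds (α - e * β)) := by
    push_cast
    exact ha.2.2.sub (hb.2.2.const_mul _)
  have hlim' : Filter.Tendsto (fun v => ((-(a v - d * b v) : ℚ) : ℝ)) Filter.atTop
      (nhds (-(α - d * β))) := by
    simp only [Rat.cast_neg]
    exact (hlim d).neg
  obtain ⟨s, hs, hsel⟩ := exists_forall_alternatingMax_le (hlim (d / 2)) hlim'
    (hlt.mono fun s hs => by push_cast; linarith) (hgt.mono fun s hs => by push_cast; linarith)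
    (n + 1)
  have hd' : (0 : ℝ) < d := by exact_mod_cast hd
  have h : α - a s ≤ d * (β - b s) := ha.le_of_forall_sub_le fun N hN => by
    have h := hn s N hN
    rw [selectedSum_eq_of_forall (P := oscillationStep a b (d / 2) d (n + 1)) hN a
      fun u h1 _ => decide_eq_true ((hsel (u + 1) (by lia)).trans h1)] at h
    push_cast at h
    rw [← inv_mul_le_iff₀ hd']
    linarith
  push_cast at hs
  linarith

/-- α is not Martin-Löf random iff its approximation converges
infinitely faster than that of a Martin-Löf random left-c.e. real Ω. -/
theorem stmt_7 (Ω α : ℝ) (Ωs αs : ℕ → ℚ) (hΩrand : MLRandom Ω)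
    (hΩ : LeftCEApprox Ωs Ω) (hα : LeftCEApprox αs α) :
    ¬ MLRandom α ↔
      Filter.Tendsto (fun s => (α - (αs s : ℝ)) / (Ω - (Ωs s : ℝ)))
        Filter.atTop (nhds 0) := by
  have hpos := hΩrand.sub_pos hΩ
  constructor
  · intro hα'
    by_contra hlim
    obtain ⟨d, hd, hfreq⟩ : ∃ d : ℚ, 0 < d ∧
        ∃ᶠ s in Filter.atTop, d * (Ω - Ωs s) < α - αs s := by
      rw [(Metric.nhds_basis_ball (x := (0 : ℝ))).tendsto_right_iff] at hlim
      simp only [not_forall, Filter.not_eventually] at hlim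
      obtain ⟨ε, hε, hfreq⟩ := hlim
      obtain ⟨d, hd0, hdε⟩ := exists_rat_btwn hε
      refine ⟨d, by exact_mod_cast hd0, hfreq.mono fun s hs => ?_⟩
      have h0 : 0 ≤ (α - αs s) / (Ω - Ωs s) :=
        div_nonneg (sub_nonneg.2 (hα.cast_le s)) (hpos s).le
      rw [Metric.mem_ball, Real.dist_0_eq_abs, abs_of_nonneg h0, not_lt] at hs
      exact (lt_div_iff₀ (hpos s)).1 (hdε.trans_le hs)
    refine hΩrand.not_oscillating hα hΩ hd ?_ hfreq
    have h := hΩrand.not_eventually_mul_le hα' hα hΩ (half_pos hd)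
    rw [Filter.not_eventually] at h
    exact h.mono fun s hs => by push_cast at hs; exact not_le.1 hs
  · intro hlim hα'
    obtain ⟨n, hn⟩ := hα'.exists_pow_mul_le hα hΩ
    obtain ⟨s, hs⟩ := (hlim.eventually_lt_const (by positivity : (0 : ℝ) < (1 / 2) ^ n)).exists
    rw [div_lt_iff₀ (hpos s)] at hs
    exact absurd (hn s) (not_le.2 hs)
end

section
/- Let α and β be left-c.e. reals in (0,1) with α + β < 1. Then for every optimal prefix-free machine determining K there is a constant c such that |K((α+β)↾n) − max(K(α↾n), K(β↾n))| ≤ c for all n. -/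
open scoped Classical

open Encodable

section RationalCodes

theorem primrec_two_pow : Primrec fun n : ℕ => 2 ^ n :=
  (Primrec₂.unpaired'.1 Nat.Primrec.pow).comp (Primrec.const 2) Primrec.id

theorem PrimrecPred.primrec_count {p : ℕ → Prop} [DecidablePred p] (hp : PrimrecPred p) :
    Primrec (Nat.count p) := by
  have step : Primrec₂ fun (k c : ℕ) => c + if p k then 1 else 0 :=
    Primrec.nat_add.comp Primrec.snd
      (Primrec.ite (hp.comp Primrec.fst) (Primrec.const 1) (Primrec.const 0))
  refine (Primrec.nat_rec₁ 0 step).of_eq fun n => ?_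
  induction n with
  | zero => simp
  | succ n ih => simp only [Nat.count_succ, ← ih]

theorem PrimrecPred.computable_nth {p : ℕ → Prop} (hp : PrimrecPred p)
    (hinf : (Set.ofPred p).Infinite) : Computable (Nat.nth p) := by
  classical
  have hdec : Primrec₂ fun k m : ℕ => decide (p m ∧ Nat.count p m = k) :=
    ((hp.comp Primrec.snd).and
      (Primrec.eq.comp (hp.primrec_count.comp Primrec.snd) Primrec.fst)).decide
  have hfind : Partrec fun k : ℕ =>
      Nat.rfind fun m => Part.some (decide (p m ∧ Nat.count p m = k)) :=
    Partrec.rfind hdec.to_comp.partrec₂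
  refine hfind.of_eq_tot fun k => ?_
  refine Nat.mem_rfind.2 ⟨by simp [Nat.nth_mem_of_infinite hinf k, Nat.count_nth_of_infinite hinf k], ?_⟩
  intro m hm
  simp only [Part.mem_some_iff, Bool.false_eq, decide_eq_false_iff_not, not_and]
  rintro hpm rfl
  rw [Nat.nth_count hpm] at hm
  exact lt_irrefl _ hm

/-- The natural numbers coding a numerator and a denominator in lowest terms. -/
def IsRatCode (m : ℕ) : Prop :=
  0 < m.unpair.2 ∧ Nat.Coprime ((m.unpair.1 + 1) / 2) m.unpair.2

theorem encode_int_ofNat (n : ℕ) : encode (Int.ofNat n) = 2 * n := rfl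

theorem encode_int_negSucc (n : ℕ) : encode (Int.negSucc n) = 2 * n + 1 := rfl

theorem natAbs_eq_encode (z : ℤ) : z.natAbs = (encode z + 1) / 2 := by
  cases z with
  | ofNat n => rw [encode_int_ofNat]; simp only [Int.ofNat_eq_natCast, Int.natAbs_natCast]; omega
  | negSucc n => rw [encode_int_negSucc]; simp only [Int.natAbs_negSucc]; omega

theorem toNat_eq_encode (z : ℤ) :
    z.toNat = if encode z % 2 = 0 then encode z / 2 else 0 := by
  cases z with
  | ofNat n => rw [encode_int_ofNat]; simp
  | negSucc n => rw [encode_int_negSucc, if_neg (by omega)]; rfl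

theorem encode_rat_eq_pair (q : ℚ) :
    Rat.instEncodable.encode q = Nat.pair (encode q.num) q.den := rfl

theorem range_encode_rat : Set.range Rat.instEncodable.encode = Set.ofPred IsRatCode := by
  ext m
  constructor
  · rintro ⟨q, rfl⟩
    change IsRatCode _
    simp only [IsRatCode, encode_rat_eq_pair, Nat.unpair_pair, ← natAbs_eq_encode]
    exact ⟨q.den_pos, q.reduced⟩
  · intro hm
    have h : 0 < m.unpair.2 ∧ Nat.Coprime ((m.unpair.1 + 1) / 2) m.unpair.2 := hm
    obtain ⟨z, hz⟩ : ∃ z : ℤ, encode z = m.unpair.1 := by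
      rcases Nat.even_or_odd' m.unpair.1 with ⟨k, hk | hk⟩
      · exact ⟨Int.ofNat k, hk.symm⟩
      · exact ⟨Int.negSucc k, hk.symm⟩
    rw [← hz, ← natAbs_eq_encode] at h
    refine ⟨⟨z, m.unpair.2, h.1.ne', h.2⟩, ?_⟩
    rw [encode_rat_eq_pair]
    simp only [hz, Nat.pair_unpair]

theorem primrecPred_isRatCode : PrimrecPred IsRatCode := by
  have num : Primrec fun m : ℕ => m.unpair.1 := Primrec.fst.comp Primrec.unpair
  have den : Primrec fun m : ℕ => m.unpair.2 := Primrec.snd.comp Primrec.unpair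
  have abs : Primrec fun m : ℕ => (m.unpair.1 + 1) / 2 :=
    Primrec.nat_div.comp (Primrec.succ.comp num) (Primrec.const 2)
  have hrel : PrimrecRel fun x m : ℕ =>
      ¬((m.unpair.1 + 1) / 2 % x = 0 ∧ m.unpair.2 % x = 0 ∧ ¬x = 1) :=
    ((Primrec.eq.comp (Primrec.nat_mod.comp (abs.comp Primrec.snd) Primrec.fst)
      (Primrec.const 0)).and
      ((Primrec.eq.comp (Primrec.nat_mod.comp (den.comp Primrec.snd) Primrec.fst)
        (Primrec.const 0)).and
        (Primrec.eq.comp Primrec.fst (Primrec.const 1)).not)).not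
  refine ((Primrec.nat_lt.comp (Primrec.const 0) den).and
    (hrel.forall_lt.comp (Primrec.succ.comp den) Primrec.id)).of_eq fun m => ?_
  refine and_congr_right fun hpos => ⟨fun h => ?_, fun h x _ hx => ?_⟩
  · by_contra hne
    refine h (Nat.gcd ((m.unpair.1 + 1) / 2) m.unpair.2)
      (Nat.lt_succ_of_le (Nat.gcd_le_right _ hpos)) ⟨?_, ?_, hne⟩
    · exact Nat.mod_eq_zero_of_dvd (Nat.gcd_dvd_left _ _)
    · exact Nat.mod_eq_zero_of_dvd (Nat.gcd_dvd_right _ _)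
  · exact hx.2.2 (Nat.eq_one_of_dvd_coprimes h (Nat.dvd_of_mod_eq_zero hx.1)
      (Nat.dvd_of_mod_eq_zero hx.2.1))

theorem infinite_isRatCode : (Set.ofPred IsRatCode).Infinite := by
  rw [← range_encode_rat]
  exact Set.infinite_range_of_injective (@encode_injective ℚ Rat.instEncodable)

theorem nth_range_encode_eq_encode_ofNat {α : Type*} [E : Encodable α] [Infinite α] (k : ℕ) :
    Nat.nth (· ∈ Set.range (@encode α E)) k =
      encode (@Denumerable.ofNat α (Denumerable.ofEncodableOfInfinite α) k) := by
  have hinf : (Set.range (@encode α E)).Infinite :=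
    Set.infinite_range_of_injective encode_injective
  have := hinf.to_subtype
  let := @decidableRangeEncode α E
  have hofNat : @Denumerable.ofNat α (Denumerable.ofEncodableOfInfinite α) k =
      (equivRangeEncode α).symm (Nat.Subtype.ofNat (Set.range (@encode α E)) k) := rfl
  have hval := congrArg Subtype.val
    ((equivRangeEncode α).apply_symm_apply (Nat.Subtype.ofNat (Set.range (@encode α E)) k))
  rw [hofNat]
  refine Eq.trans ?_ hval.symm
  rw [← Nat.Subtype.orderIsoOfNat_apply]
  exact Nat.nth_apply_eq_orderIsoOfNat (p := (· ∈ Set.range (@encode α E))) hinf k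

theorem computable_rat_pair :
    Computable fun q : ℚ => Nat.pair (encode q.num) q.den := by
  have hcode : (· ∈ Set.range Rat.instEncodable.encode) = IsRatCode :=
    funext fun m => congrArg (m ∈ ·) range_encode_rat
  refine ((primrecPred_isRatCode.computable_nth infinite_isRatCode).comp
    Computable.encode).of_eq fun q => ?_
  rw [← hcode, nth_range_encode_eq_encode_ofNat, ← encode_rat_eq_pair]
  exact congrArg _ (Denumerable.ofNat_encode q)

theorem computable_rat_den : Computable Rat.den :=
  (Computable.snd.comp (Computable.unpair.comp computable_rat_pair)).of_eq fun q => by simp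

theorem computable_rat_num_toNat : Computable fun q : ℚ => q.num.toNat := by
  have hnat : Primrec fun a : ℕ => if a % 2 = 0 then a / 2 else 0 :=
    Primrec.ite (Primrec.eq.comp (Primrec.nat_mod.comp Primrec.id (Primrec.const 2))
      (Primrec.const 0)) (Primrec.nat_div.comp Primrec.id (Primrec.const 2)) (Primrec.const 0)
  refine (hnat.to_comp.comp (Computable.fst.comp
    (Computable.unpair.comp computable_rat_pair))).of_eq fun q => ?_
  simp only [Nat.unpair_pair, toNat_eq_encode]

theorem floor_rat_mul_two_pow (q : ℚ) (n : ℕ) :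
    ⌊(q : ℝ) * 2 ^ n⌋₊ = q.num.toNat * 2 ^ n / q.den := by
  rcases le_or_gt 0 q with hq | hq
  · have hnum : ((q.num.toNat : ℕ) : ℝ) = (q.num : ℝ) := by
      have : ((q.num.toNat : ℕ) : ℤ) = q.num := Int.toNat_of_nonneg (Rat.num_nonneg.2 hq)
      exact_mod_cast this
    rw [← Nat.floor_div_eq_div (K := ℝ)]
    congr 1
    push_cast
    rw [hnum, Rat.cast_def]
    ring
  · have hnum : q.num.toNat = 0 := Int.toNat_of_nonpos (Rat.num_nonpos.2 hq.le)
    rw [hnum, Nat.floor_of_nonpos]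
    · simp
    · exact mul_nonpos_of_nonpos_of_nonneg (by exact_mod_cast hq.le) (by positivity)

theorem computable₂_floor_mul_two_pow {q : ℕ → ℚ} (hq : Computable q) :
    Computable₂ fun s n : ℕ => ⌊(q s : ℝ) * 2 ^ n⌋₊ := by
  have hnum : Computable fun x : ℕ × ℕ => (q x.1).num.toNat * 2 ^ x.2 :=
    Primrec.nat_mul.to_comp.comp (computable_rat_num_toNat.comp (hq.comp Computable.fst))
      (primrec_two_pow.to_comp.comp Computable.snd)
  have hdiv : Computable fun x : ℕ × ℕ => (q x.1).num.toNat * 2 ^ x.2 / (q x.1).den :=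
    Primrec.nat_div.to_comp.comp hnum (computable_rat_den.comp (hq.comp Computable.fst))
  exact hdiv.of_eq fun x => (floor_rat_mul_two_pow _ _).symm

end RationalCodes

section BinaryExpansions

/-- The number whose binary expansion, most significant digit first, is the given string. -/
def natOfBits (l : List Bool) : ℕ := l.foldl (fun a b => 2 * a + b.toNat) 0

/-- The last `n` binary digits of a natural number, most significant digit first. -/
def bitsOfNat (n m : ℕ) : List Bool :=
  (List.range n).map fun i => decide (m / 2 ^ (n - 1 - i) % 2 = 1)

theorem primrec_natOfBits : Primrec natOfBits := by
  have step : Primrec₂ fun (_ : List Bool) (x : ℕ × Bool) => 2 * x.1 + x.2.toNat :=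
    Primrec.nat_add.comp
      (Primrec.nat_mul.comp (Primrec.const 2) (Primrec.fst.comp Primrec.snd))
      ((Primrec.dom_bool Bool.toNat).comp (Primrec.snd.comp Primrec.snd))
  exact Primrec.list_foldl Primrec.id (Primrec.const 0) step

theorem primrec₂_bitsOfNat : Primrec₂ bitsOfNat := by
  refine Primrec.list_map (Primrec.list_range.comp Primrec.fst) (PrimrecPred.decide ?_)
  exact Primrec.eq.comp (Primrec.nat_mod.comp (Primrec.nat_div.comp
    (Primrec.snd.comp Primrec.fst) (primrec_two_pow.comp (Primrec.nat_sub.comp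
      (Primrec.nat_sub.comp (Primrec.fst.comp Primrec.fst) (Primrec.const 1)) Primrec.snd)))
    (Primrec.const 2)) (Primrec.const 1)

theorem length_bits (x : ℝ) (n : ℕ) : (bits x n).length = n := by simp [bits]

theorem rdigit_eq_decide {x : ℝ} (hx : 0 ≤ x) (i : ℕ) :
    rdigit x i = decide (⌊x * 2 ^ (i + 1)⌋₊ % 2 = 1) := by
  have h : ⌊x * 2 ^ (i + 1)⌋ = ((⌊x * 2 ^ (i + 1)⌋₊ : ℕ) : ℤ) :=
    (Int.natCast_floor_eq_floor (by positivity)).symm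
  rw [rdigit, h, decide_eq_decide]
  omega

theorem floor_mul_two_pow_div (x : ℝ) (m k : ℕ) :
    ⌊x * 2 ^ (m + k)⌋₊ / 2 ^ k = ⌊x * 2 ^ m⌋₊ := by
  rw [← Nat.floor_div_natCast]
  congr 1
  push_cast
  rw [pow_add]
  field_simp

theorem bits_eq_bitsOfNat {x : ℝ} (hx : 0 ≤ x) (n : ℕ) :
    bits x n = bitsOfNat n ⌊x * 2 ^ n⌋₊ := by
  refine List.map_congr_left fun i hi => ?_
  rw [List.mem_range] at hi
  have h := floor_mul_two_pow_div x (i + 1) (n - 1 - i)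
  rw [show i + 1 + (n - 1 - i) = n by omega] at h
  rw [rdigit_eq_decide hx, h]

theorem natOfBits_bits {x : ℝ} (hx : x ∈ Set.Ico (0 : ℝ) 1) (n : ℕ) :
    natOfBits (bits x n) = ⌊x * 2 ^ n⌋₊ := by
  induction n with
  | zero => simp [bits, natOfBits, Nat.floor_eq_zero.2 hx.2]
  | succ n ih =>
    have hstep : natOfBits (bits x (n + 1)) =
        2 * natOfBits (bits x n) + (rdigit x n).toNat := by
      simp [bits, natOfBits, List.range_succ]
    have hdiv := floor_mul_two_pow_div x n 1
    rw [pow_one] at hdiv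
    rw [hstep, ih, rdigit_eq_decide hx.1]
    rcases Nat.mod_two_eq_zero_or_one ⌊x * 2 ^ (n + 1)⌋₊ with h | h <;> simp [h] <;> omega

end BinaryExpansions

section Complexity

/-- The prefix-free machine that applies a partial computable function to the output of `V`. -/
def PFMachine.postcomp (V : PFMachine) (F : List Bool →. List Bool) (hF : Partrec F) :
    PFMachine where
  f p := (V.f p).bind F
  partrec := V.partrec.bind (hF.comp Computable.snd)
  prefixFree σ hσ τ hτ := V.prefixFree σ hσ.fst τ hτ.fst

theorem Kf_postcomp_le (V : PFMachine) {F : List Bool →. List Bool} (hF : Partrec F)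
    {σ τ : List Bool} (h : τ ∈ F σ) : Kf (V.postcomp F hF) τ ≤ Kf V σ :=
  le_iInf fun p => iInf_le_of_le ⟨p.1, Part.mem_bind p.2 h⟩ le_rfl

theorem OptimalPF.exists_Kf_le {V : PFMachine} (hV : OptimalPF V)
    {F : List Bool →. List Bool} (hF : Partrec F) :
    ∃ c : ℕ, ∀ σ τ : List Bool, τ ∈ F σ → Kf V τ ≤ Kf V σ + c := by
  obtain ⟨c, hc⟩ := hV (V.postcomp F hF)
  exact ⟨c, fun σ τ h => (hc τ).trans (by gcongr; exact Kf_postcomp_le V hF h)⟩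

theorem OptimalPF.exists_Kf_le_of_lt {V : PFMachine} (hV : OptimalPF V)
    {F : ℕ → List Bool →. List Bool} (hF : ∀ i, Partrec (F i)) (k : ℕ) :
    ∃ c : ℕ, ∀ i < k, ∀ σ τ : List Bool, τ ∈ F i σ → Kf V τ ≤ Kf V σ + c := by
  choose c hc using fun i => hV.exists_Kf_le (hF i)
  refine ⟨∑ i ∈ Finset.range k, c i, fun i hi σ τ h => (hc i σ τ h).trans ?_⟩
  gcongr
  exact Finset.single_le_sum (f := c) (fun _ _ => Nat.zero_le _) (Finset.mem_range.2 hi)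

/-- If the first stage at which `a` comes within `j` of `x * 2 ^ n` is a stage at which `b` is
within `k` of `y * 2 ^ n`, then the first `n` bits of `y` are at most as complex as those
of `x`. -/
theorem OptimalPF.exists_Kf_bits_le {V : PFMachine} (hV : OptimalPF V) {a b : ℕ → ℕ → ℕ}
    (ha : Computable₂ a) (hb : Computable₂ b) (j k : ℕ) :
    ∃ c : ℕ, ∀ (x y : ℝ) (n s : ℕ), x ∈ Set.Ico (0 : ℝ) 1 → 0 ≤ y →
      ⌊x * 2 ^ n⌋₊ ≤ a s n + j → (∀ t < s, a t n + j < ⌊x * 2 ^ n⌋₊) →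
      b s n ≤ ⌊y * 2 ^ n⌋₊ → ⌊y * 2 ^ n⌋₊ ≤ b s n + k →
      Kf V (bits y n) ≤ Kf V (bits x n) + c := by
  have hstage : Partrec fun σ : List Bool =>
      Nat.rfind fun s => Part.some (decide (natOfBits σ ≤ a s σ.length + j)) := by
    refine Partrec.rfind (Computable.partrec ?_)
    exact Primrec.nat_le.decide.to_comp.comp
      (primrec_natOfBits.to_comp.comp Computable.fst)
      (Primrec.nat_add.to_comp.comp
        (ha.comp Computable.snd (Computable.list_length.comp Computable.fst))
        (Computable.const j))
  have hF : ∀ i, Partrec fun σ : List Bool =>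
      (Nat.rfind fun s => Part.some (decide (natOfBits σ ≤ a s σ.length + j))).map
        fun s => bitsOfNat σ.length (b s σ.length + i) := fun i =>
    hstage.map <| primrec₂_bitsOfNat.to_comp.comp
      (Computable.list_length.comp Computable.fst)
      (Primrec.nat_add.to_comp.comp
        (hb.comp Computable.snd (Computable.list_length.comp Computable.fst))
        (Computable.const i))
  obtain ⟨c, hc⟩ := hV.exists_Kf_le_of_lt hF (k + 1)
  refine ⟨c, fun x y n s hx hy hs hmin hle hge => ?_⟩
  refine hc (⌊y * 2 ^ n⌋₊ - b s n) (by omega) _ _ (Part.mem_map_iff _ |>.2 ⟨s, ?_, ?_⟩)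
  · refine Nat.mem_rfind.2 ⟨?_, fun {t} ht => ?_⟩
    · simpa [natOfBits_bits hx, length_bits] using hs
    · simpa [natOfBits_bits hx, length_bits] using hmin t ht
  · rw [length_bits, bits_eq_bitsOfNat hy, Nat.add_sub_cancel' hle]

end Complexity

section LeftCEReals

theorem LeftCEApprox.le {q : ℕ → ℚ} {x : ℝ} (h : LeftCEApprox q x) (s : ℕ) : (q s : ℝ) ≤ x :=
  Monotone.ge_of_tendsto (fun _ _ hst => Rat.cast_le.2 (h.2.1 hst)) h.2.2 s

theorem LeftCEApprox.monotone_floor {q : ℕ → ℚ} {x : ℝ} (h : LeftCEApprox q x) (n : ℕ) :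
    Monotone fun s => ⌊(q s : ℝ) * 2 ^ n⌋₊ := fun s t hst =>
  Nat.floor_mono (by have : (q s : ℝ) ≤ q t := Rat.cast_le.2 (h.2.1 hst); gcongr)

theorem LeftCEApprox.floor_le {q : ℕ → ℚ} {x : ℝ} (h : LeftCEApprox q x) (s n : ℕ) :
    ⌊(q s : ℝ) * 2 ^ n⌋₊ ≤ ⌊x * 2 ^ n⌋₊ :=
  Nat.floor_mono (by have := h.le s; gcongr)

theorem LeftCEApprox.exists_floor_le_succ {q : ℕ → ℚ} {x : ℝ} (h : LeftCEApprox q x) (n : ℕ) :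
    ∃ s, ⌊x * 2 ^ n⌋₊ ≤ ⌊(q s : ℝ) * 2 ^ n⌋₊ + 1 := by
  have hlt : x * 2 ^ n - 1 < x * 2 ^ n := by linarith
  obtain ⟨s, hs⟩ := ((h.2.2.mul_const ((2 : ℝ) ^ n)).eventually (lt_mem_nhds hlt)).exists
  refine ⟨s, ?_⟩
  rw [← Nat.lt_add_one_iff]
  have hq := Nat.lt_floor_add_one ((q s : ℝ) * 2 ^ n)
  refine Nat.floor_lt' (by omega) |>.2 ?_
  push_cast
  linarith

theorem floor_add_le {u v : ℝ} (hu : 0 ≤ u) (hv : 0 ≤ v) :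
    ⌊u⌋₊ + ⌊v⌋₊ ≤ ⌊u + v⌋₊ ∧ ⌊u + v⌋₊ ≤ ⌊u⌋₊ + ⌊v⌋₊ + 1 := by
  have hu' := Nat.floor_le hu
  have hv' := Nat.floor_le hv
  have hu'' := Nat.lt_floor_add_one u
  have hv'' := Nat.lt_floor_add_one v
  constructor
  · refine Nat.le_floor ?_
    push_cast
    linarith
  · rw [← Nat.lt_add_one_iff]
    refine (Nat.floor_lt (by positivity)).2 ?_
    push_cast
    linarith

theorem OptimalPF.exists_Kf_bits_add_le {V : PFMachine} (hV : OptimalPF V) {α β : ℝ}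
    (hα : α ∈ Set.Ico (0 : ℝ) 1) (hβ : β ∈ Set.Ico (0 : ℝ) 1) (hαl : LeftCE α) (hβl : LeftCE β) :
    ∃ c : ℕ, ∀ n, Kf V (bits (α + β) n) ≤ max (Kf V (bits α n)) (Kf V (bits β n)) + c := by
  obtain ⟨q, hq⟩ := hαl
  obtain ⟨r, hr⟩ := hβl
  have hqc := computable₂_floor_mul_two_pow hq.1
  have hrc := computable₂_floor_mul_two_pow hr.1
  have hsc := Primrec.nat_add.to_comp.comp₂ hqc hrc
  obtain ⟨c, hc⟩ := hV.exists_Kf_bits_le hqc hsc 1 3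
  obtain ⟨d, hd⟩ := hV.exists_Kf_bits_le hrc hsc 1 3
  refine ⟨max c d, fun n => ?_⟩
  have hsum := floor_add_le (mul_nonneg hα.1 (pow_nonneg zero_le_two n))
    (mul_nonneg hβ.1 (pow_nonneg zero_le_two n))
  rw [← add_mul] at hsum
  have hqe := hq.exists_floor_le_succ n
  have hre := hr.exists_floor_le_succ n
  have hqs := Nat.find_spec hqe
  have hrs := Nat.find_spec hre
  have hq_le := hq.floor_le
  have hr_le := hr.floor_le
  rcases le_total (Nat.find hre) (Nat.find hqe) with h | h
  · have hmono := hr.monotone_floor n h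
    dsimp only at hmono
    have h₁ := hq_le (Nat.find hqe) n
    have h₂ := hr_le (Nat.find hqe) n
    refine (hc α (α + β) n (Nat.find hqe) hα (add_nonneg hα.1 hβ.1) hqs
      (fun t ht => not_le.1 (Nat.find_min hqe ht)) (by omega) (by omega)).trans ?_
    gcongr <;> simp
  · have hmono := hq.monotone_floor n h
    dsimp only at hmono
    have h₁ := hq_le (Nat.find hre) n
    have h₂ := hr_le (Nat.find hre) n
    refine (hd β (α + β) n (Nat.find hre) hβ (add_nonneg hα.1 hβ.1) hrs
      (fun t ht => not_le.1 (Nat.find_min hre ht)) (by omega) (by omega)).trans ?_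
    gcongr <;> simp

theorem OptimalPF.exists_Kf_bits_le_add {V : PFMachine} (hV : OptimalPF V) {α β : ℝ}
    (hα : 0 ≤ α) (hβ : 0 ≤ β) (hsum : α + β < 1) (hαl : LeftCE α) (hβl : LeftCE β) :
    ∃ c : ℕ, ∀ n, Kf V (bits α n) ≤ Kf V (bits (α + β) n) + c := by
  obtain ⟨q, hq⟩ := hαl
  obtain ⟨r, hr⟩ := hβl
  have hqc := computable₂_floor_mul_two_pow hq.1
  have hrc := computable₂_floor_mul_two_pow hr.1
  obtain ⟨c, hc⟩ := hV.exists_Kf_bits_le (Primrec.nat_add.to_comp.comp₂ hqc hrc) hqc 3 3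
  refine ⟨c, fun n => ?_⟩
  have hfloor := floor_add_le (mul_nonneg hα (pow_nonneg zero_le_two n))
    (mul_nonneg hβ (pow_nonneg zero_le_two n))
  rw [← add_mul] at hfloor
  have hex : ∃ s, ⌊(α + β) * 2 ^ n⌋₊ ≤ ⌊(q s : ℝ) * 2 ^ n⌋₊ + ⌊(r s : ℝ) * 2 ^ n⌋₊ + 3 := by
    obtain ⟨s, hs⟩ := hq.exists_floor_le_succ n
    obtain ⟨t, ht⟩ := hr.exists_floor_le_succ n
    have h₁ := hq.monotone_floor n (le_max_left s t)
    have h₂ := hr.monotone_floor n (le_max_right s t)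
    dsimp only at h₁ h₂
    exact ⟨max s t, by omega⟩
  have hs := Nat.find_spec hex
  have hq_le := hq.floor_le (Nat.find hex) n
  have hr_le := hr.floor_le (Nat.find hex) n
  exact hc (α + β) α n (Nat.find hex) ⟨add_nonneg hα hβ, hsum⟩ hα hs
    (fun t ht => not_le.1 (Nat.find_min hex ht)) hq_le (by omega)

end LeftCEReals

/-- For left-c.e. reals α, β in (0,1) with α + β < 1, the prefix-free
complexity of (α+β)↾n equals max(K(α↾n), K(β↾n)) up to an additive constant. -/
theorem stmt_9 (α β : ℝ) (hα : α ∈ Set.Ioo (0:ℝ) 1) (hβ : β ∈ Set.Ioo (0:ℝ) 1)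
    (hαl : LeftCE α) (hβl : LeftCE β) (hsum : α + β < 1)
    (V : PFMachine) (hV : OptimalPF V) :
    ∃ c : ℕ, ∀ n : ℕ,
      Kf V (bits (α + β) n) ≤ max (Kf V (bits α n)) (Kf V (bits β n)) + (c : ℕ∞) ∧
      max (Kf V (bits α n)) (Kf V (bits β n)) ≤ Kf V (bits (α + β) n) + (c : ℕ∞) := by
  obtain ⟨c, hc⟩ := hV.exists_Kf_bits_add_le (Set.Ioo_subset_Ico_self hα)
    (Set.Ioo_subset_Ico_self hβ) hαl hβl
  obtain ⟨d, hd⟩ := hV.exists_Kf_bits_le_add hα.1.le hβ.1.le hsum hαl hβl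
  obtain ⟨e, he⟩ := hV.exists_Kf_bits_le_add hβ.1.le hα.1.le (add_comm α β ▸ hsum) hβl hαl
  refine ⟨max c (max d e), fun n => ⟨(hc n).trans ?_, max_le ((hd n).trans ?_) ?_⟩⟩
  · gcongr
    exact le_max_left _ _
  · gcongr
    exact (le_max_left d e).trans (le_max_right c _)
  · rw [add_comm α β]
    refine (he n).trans ?_
    gcongr
    exact (le_max_right d e).trans (le_max_right c _)
end
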